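/- arXiv:1402.4258 — 7 statements merged into one kernel-verified Lean document; each statement's English description precedes it below -/
import Mathlib

section
/- Assume every hyperedge is nonempty, i.e. v i ≠ ∅ for all i : I. Then for every set of hyperedges X× ⊆ I, the hyperedge erosion satisfies εE(X×) = {j ∈ X× | for every i ∉ X×, v j ∩ v i = ∅}. -/
/-- Vertex dilation from hyperedges: δ•(X×) = ⋃_{j ∈ X×} v j. -/
def dilV {V I : Type*} (v : I → Set V) (X : Set I) : Set V := ⋃ j ∈ X, v j

/-- Hyperedge erosion from vertices: ε×(X•) = {i | v i ⊆ X•}. -/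
def eroE {V I : Type*} (v : I → Set V) (X : Set V) : Set I := {i | v i ⊆ X}

/-- Vertex erosion from hyperedges: ε•(X×) = ⋂_{j ∉ X×} (v j)ᶜ. -/
def eroV {V I : Type*} (v : I → Set V) (X : Set I) : Set V := ⋂ j ∈ Xᶜ, (v j)ᶜ

/-- Hyperedge dilation from vertices: δ×(X•) = {i | v i ∩ X• ≠ ∅}. -/
def dilE {V I : Type*} (v : I → Set V) (X : Set V) : Set I := {i | v i ∩ X ≠ ∅}

/-- Vertex dilation δ = δ• ∘ δ×. -/
def dil {V I : Type*} (v : I → Set V) : Set V → Set V := dilV v ∘ dilE v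

/-- Vertex erosion ε = ε• ∘ ε×. -/
def ero {V I : Type*} (v : I → Set V) : Set V → Set V := eroV v ∘ eroE v

/-- Hyperedge dilation Δ = δ× ∘ δ•. -/
def dilEdge {V I : Type*} (v : I → Set V) : Set I → Set I := dilE v ∘ dilV v

/-- Hyperedge erosion εE = ε× ∘ ε•. -/
def eroEdge {V I : Type*} (v : I → Set V) : Set I → Set I := eroE v ∘ eroV v

/-- Half-opening γ½ = δ• ∘ ε×. -/
def gammaHalf {V I : Type*} (v : I → Set V) : Set V → Set V := dilV v ∘ eroE v

/-- Half-closing φ½ = ε• ∘ δ×. -/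
def phiHalf {V I : Type*} (v : I → Set V) : Set V → Set V := eroV v ∘ dilE v

/-- Hyperedge half-opening Γ½ = δ× ∘ ε•. -/
def GammaHalf {V I : Type*} (v : I → Set V) : Set I → Set I := dilE v ∘ eroV v

/-- Hyperedge half-closing Φ½ = ε× ∘ δ•. -/
def PhiHalf {V I : Type*} (v : I → Set V) : Set I → Set I := eroE v ∘ dilV v

/-- A pair (X•, X×) is a subhypergraph of H when v j ⊆ X• for every j ∈ X×. -/
def IsSubhypergraph {V I : Type*} (v : I → Set V) (Xv : Set V) (Xe : Set I) : Prop :=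
  ∀ j ∈ Xe, v j ⊆ Xv

/-- Local characterization of the hyperedge erosion εE = ε× ∘ ε•, when all hyperedges
are nonempty. -/
theorem eroEdge_eq {V I : Type*} (v : I → Set V) (hv : ∀ i : I, v i ≠ ∅) (Xe : Set I) :
    eroEdge v Xe = {j : I | j ∈ Xe ∧ ∀ i ∉ Xe, v j ∩ v i = ∅} := by
  have key : ∀ j, j ∈ eroEdge v Xe ↔ ∀ i ∉ Xe, v j ∩ v i = ∅ := by
    intro j
    simp only [eroEdge, Function.comp_apply, eroE, eroV, Set.mem_ofPred_eq, Set.subset_iInter_iff,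
      Set.subset_compl_iff_disjoint_right, Set.disjoint_iff_inter_eq_empty, Set.mem_compl_iff]
  ext j
  rw [key, Set.mem_ofPred_eq]
  refine ⟨fun h => ⟨?_, h⟩, And.right⟩
  by_contra hj
  exact hv j (by simpa using h j hj)
end

section
/- The pair (ε, δ) is an adjunction on the lattice of subsets of V and the pair (εE, Δ) is an adjunction on the lattice of subsets of I: for all X•, Y• ⊆ V, δ(X•) ⊆ Y• if and only if X• ⊆ ε(Y•); and for all X×, Y× ⊆ I, Δ(X×) ⊆ Y× if and only if X× ⊆ εE(Y×). Moreover ε and δ are dual: ε(X•) = (δ((X•)ᶜ))ᶜ for every X• ⊆ V. -/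
theorem gc_dilV_eroE {V I : Type*} (v : I → Set V) : GaloisConnection (dilV v) (eroE v) :=
  fun _ _ => Set.iUnion₂_subset_iff

theorem gc_dilE_eroV {V I : Type*} (v : I → Set V) : GaloisConnection (dilE v) (eroV v) := by
  intro X Y
  simp only [dilE, eroV, Set.subset_iInter_iff, Set.subset_compl_iff_disjoint_left,
    Set.disjoint_iff_inter_eq_empty]
  exact forall_congr' fun _ => not_imp_comm

theorem compl_dilV {V I : Type*} (v : I → Set V) (X : Set I) : (dilV v X)ᶜ = eroV v Xᶜ := by
  simp [dilV, eroV]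

theorem dilE_compl {V I : Type*} (v : I → Set V) (X : Set V) : dilE v Xᶜ = (eroE v X)ᶜ := by
  ext i
  simp [dilE, eroE, ← Set.sdiff_eq, Set.sdiff_eq_empty]

/-- (ε, δ) and (εE, Δ) are adjunctions, and ε, δ are dual. -/
theorem adjunctions_and_duality {V I : Type*} (v : I → Set V) :
    (∀ Xv Yv : Set V, dil v Xv ⊆ Yv ↔ Xv ⊆ ero v Yv) ∧
    (∀ Xe Ye : Set I, dilEdge v Xe ⊆ Ye ↔ Xe ⊆ eroEdge v Ye) ∧
    (∀ Xv : Set V, ero v Xv = (dil v Xvᶜ)ᶜ) := by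
  refine ⟨(gc_dilE_eroV v).compose (gc_dilV_eroE v), (gc_dilV_eroE v).compose (gc_dilE_eroV v),
    fun X => ?_⟩
  simp only [ero, dil, Function.comp_apply, compl_dilV, dilE_compl, compl_compl]
end

section
/- The hypergraph erosion maps subhypergraphs to subhypergraphs: if (X•, X×) is a subhypergraph of H (i.e. v j ⊆ X• for every j ∈ X×), then (ε(X•), εE(X×)) is also a subhypergraph of H, i.e. for every j ∈ εE(X×) one has v j ⊆ ε(X•). -/
theorem eroV_mono {V I : Type*} (v : I → Set V) : Monotone (eroV v) := fun _ _ hXY =>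
  Set.biInter_subset_biInter_left (Set.compl_subset_compl.mpr hXY)

/-- The hypergraph erosion maps subhypergraphs to subhypergraphs. -/
theorem erosion_subhypergraph {V I : Type*} (v : I → Set V) (Xv : Set V) (Xe : Set I)
    (h : IsSubhypergraph v Xv Xe) :
    IsSubhypergraph v (ero v Xv) (eroEdge v Xe) := by
  exact fun _ hj => Set.Subset.trans hj (eroV_mono v h)
end

section
/- The pair ([ε, εE], [δ, Δ]) is an adjunction on the lattice of subhypergraphs of H ordered componentwise by inclusion: for all subhypergraphs (X•, X×) and (Y•, Y×) of H, one has (δ(X•) ⊆ Y• and Δ(X×) ⊆ Y×) if and only if (X• ⊆ ε(Y•) and X× ⊆ εE(Y×)). -/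
theorem dilV_subset_iff {V I : Type*} (v : I → Set V) (X : Set I) (Y : Set V) :
    dilV v X ⊆ Y ↔ X ⊆ eroE v Y :=
  Set.iUnion₂_subset_iff

theorem dilE_subset_iff {V I : Type*} (v : I → Set V) (X : Set V) (Y : Set I) :
    dilE v X ⊆ Y ↔ X ⊆ eroV v Y := by
  simp only [eroV, Set.subset_iInter₂_iff, Set.subset_compl_iff_disjoint_left,
    Set.disjoint_iff_inter_eq_empty]
  exact forall_congr' fun _ => not_imp_comm

/-- ([ε, εE], [δ, Δ]) is an adjunction on the lattice of subhypergraphs. -/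
theorem adjunction_subhypergraphs {V I : Type*} (v : I → Set V)
    (Xv Yv : Set V) (Xe Ye : Set I)
    (hX : IsSubhypergraph v Xv Xe) (hY : IsSubhypergraph v Yv Ye) :
    (dil v Xv ⊆ Yv ∧ dilEdge v Xe ⊆ Ye) ↔ (Xv ⊆ ero v Yv ∧ Xe ⊆ eroEdge v Ye) := by
  exact and_congr ((dilV_subset_iff v _ _).trans (dilE_subset_iff v _ _))
    ((dilE_subset_iff v _ _).trans (dilV_subset_iff v _ _))
end

section
/- For every set of vertices X• ⊆ V one has the chain of inclusions γ₁(X•) ⊆ γ½(X•) ⊆ X• ⊆ φ½(X•) ⊆ φ₁(X•), and for every set of hyperedges X× ⊆ I one has Γ₁(X×) ⊆ Γ½(X×) ⊆ X× ⊆ Φ½(X×) ⊆ Φ₁(X×). -/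
/-- Opening γ₁ = δ ∘ ε on subsets of V. -/
def gammaOne {V I : Type*} (v : I → Set V) : Set V → Set V := dil v ∘ ero v

/-- Closing φ₁ = ε ∘ δ on subsets of V. -/
def phiOne {V I : Type*} (v : I → Set V) : Set V → Set V := ero v ∘ dil v

/-- Opening Γ₁ = Δ ∘ εE on subsets of I. -/
def GammaOne {V I : Type*} (v : I → Set V) : Set I → Set I := dilEdge v ∘ eroEdge v

/-- Closing Φ₁ = εE ∘ Δ on subsets of I. -/
def PhiOne {V I : Type*} (v : I → Set V) : Set I → Set I := eroEdge v ∘ dilEdge v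

/-- Chains of inclusions between openings, half-openings, half-closings and closings. -/
theorem chains {V I : Type*} (v : I → Set V) :
    (∀ Xv : Set V, gammaOne v Xv ⊆ gammaHalf v Xv ∧ gammaHalf v Xv ⊆ Xv ∧
      Xv ⊆ phiHalf v Xv ∧ phiHalf v Xv ⊆ phiOne v Xv) ∧
    (∀ Xe : Set I, GammaOne v Xe ⊆ GammaHalf v Xe ∧ GammaHalf v Xe ⊆ Xe ∧
      Xe ⊆ PhiHalf v Xe ∧ PhiHalf v Xe ⊆ PhiOne v Xe) := by
  have h := gc_dilV_eroE v
  have k := gc_dilE_eroV v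
  exact ⟨fun Xv => ⟨h.monotone_l (k.l_u_le _), h.l_u_le Xv, k.le_u_l Xv, k.monotone_u (h.le_u_l _)⟩,
    fun Xe => ⟨k.monotone_l (h.l_u_le _), k.l_u_le Xe, h.le_u_l Xe, h.monotone_u (k.le_u_l _)⟩⟩
end

section
/- The family of subhypergraphs of H is closed under the half-opening and half-closing: if (X•, X×) is a subhypergraph of H (i.e. v j ⊆ X• for every j ∈ X×), then (γ½(X•), Γ½(X×)) is a subhypergraph of H (i.e. v i ⊆ γ½(X•) for every i ∈ Γ½(X×)), and (φ½(X•), Φ½(X×)) is a subhypergraph of H (i.e. v i ⊆ φ½(X•) for every i ∈ Φ½(X×)). -/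
/-- A hyperedge meeting the vertex erosion of `X` belongs to `X`. -/
theorem GammaHalf_subset {V I : Type*} (v : I → Set V) (X : Set I) : GammaHalf v X ⊆ X := by
  intro i hi
  obtain ⟨x, hx, hxX⟩ := Set.nonempty_iff_ne_empty.mpr hi
  by_contra hiX
  exact Set.mem_iInter₂.mp hxX i hiX hx

/-- The half-closing on vertices is extensive. -/
theorem subset_phiHalf {V I : Type*} (v : I → Set V) (X : Set V) : X ⊆ phiHalf v X := by
  intro x hx
  refine Set.mem_iInter₂.mpr fun j hj hxj => hj ?_
  exact Set.nonempty_iff_ne_empty.mp ⟨x, hxj, hx⟩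

/-- Subhypergraphs are closed under the half-opening and the half-closing. -/
theorem half_opening_closing_subhypergraph {V I : Type*} (v : I → Set V)
    (Xv : Set V) (Xe : Set I) (h : IsSubhypergraph v Xv Xe) :
    IsSubhypergraph v (gammaHalf v Xv) (GammaHalf v Xe) ∧
    IsSubhypergraph v (phiHalf v Xv) (PhiHalf v Xe) := by
  refine ⟨fun i hi => ?_, fun i hi => ?_⟩
  · exact Set.subset_biUnion_of_mem (u := v) (h i (GammaHalf_subset v Xe hi))
  · have hi' : v i ⊆ ⋃ j ∈ Xe, v j := hi
    exact (hi'.trans (Set.iUnion₂_subset h)).trans (subset_phiHalf v Xv)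
end

section
/- The families {γ_{λ/2} | λ ∈ ℕ} and {Γ_{λ/2} | λ ∈ ℕ} are granulometries: (i) for every λ ∈ ℕ, γ_{λ/2} is an opening on subsets of V (increasing, idempotent and anti-extensive) and Γ_{λ/2} is an opening on subsets of I; (ii) the families are decreasing in λ: for all λ ≤ μ in ℕ, every X• ⊆ V and every X× ⊆ I, one has γ_{μ/2}(X•) ⊆ γ_{λ/2}(X•) and Γ_{μ/2}(X×) ⊆ Γ_{λ/2}(X×). -/
/-- γ_{λ/2} = δ^i ∘ (γ½)^j ∘ ε^i where λ = 2 i + j, j ∈ {0,1}. -/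
def gammaLam {V I : Type*} (v : I → Set V) (lam : ℕ) : Set V → Set V :=
  (dil v)^[lam / 2] ∘ (gammaHalf v)^[lam % 2] ∘ (ero v)^[lam / 2]

/-- Γ_{λ/2} = Δ^i ∘ (Γ½)^j ∘ εE^i where λ = 2 i + j, j ∈ {0,1}. -/
def GammaLam {V I : Type*} (v : I → Set V) (lam : ℕ) : Set I → Set I :=
  (dilEdge v)^[lam / 2] ∘ (GammaHalf v)^[lam % 2] ∘ (eroEdge v)^[lam / 2]

theorem GaloisConnection.iterate_iterate {α : Type*} [Preorder α] {l u : α → α}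
    (h : GaloisConnection l u) (n : ℕ) : GaloisConnection l^[n] u^[n] := by
  induction n with
  | zero => exact GaloisConnection.id
  | succ n ih =>
    rw [Function.iterate_succ l, Function.iterate_succ' u]
    exact h.compose ih

/-- The composite of the lower and upper adjoints of a Galois connection is an opening. -/
theorem GaloisConnection.opening {α β : Type*} [PartialOrder α] [PartialOrder β] {l : α → β}
    {u : β → α} (h : GaloisConnection l u) :
    Monotone (l ∘ u) ∧ (∀ x, (l ∘ u) ((l ∘ u) x) = (l ∘ u) x) ∧ ∀ x, (l ∘ u) x ≤ x :=
  ⟨h.monotone_l.comp h.monotone_u, fun x => h.l_u_l_eq_l (u x), h.l_u_le⟩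

/-- The alternating composites of two Galois connections `l₁ ⊣ u₁` and `l₂ ⊣ u₂`. -/
def alternatingOpening {α β : Type*} (l₁ : β → α) (u₁ : α → β) (l₂ : α → β) (u₂ : β → α)
    (n : ℕ) : α → α :=
  (l₁ ∘ l₂)^[n / 2] ∘ (l₁ ∘ u₁)^[n % 2] ∘ (u₂ ∘ u₁)^[n / 2]

section AlternatingOpening

variable {α β : Type*} {l₁ : β → α} {u₁ : α → β} {l₂ : α → β} {u₂ : β → α}

theorem alternatingOpening_two_mul (k : ℕ) :
    alternatingOpening l₁ u₁ l₂ u₂ (2 * k) = (l₁ ∘ l₂)^[k] ∘ (u₂ ∘ u₁)^[k] := by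
  simp [alternatingOpening]

theorem alternatingOpening_two_mul_add_one (k : ℕ) :
    alternatingOpening l₁ u₁ l₂ u₂ (2 * k + 1) =
      ((l₁ ∘ l₂)^[k] ∘ l₁) ∘ (u₁ ∘ (u₂ ∘ u₁)^[k]) := by
  have hdiv : (2 * k + 1) / 2 = k := by omega
  have hmod : (2 * k + 1) % 2 = 1 := by omega
  rw [alternatingOpening, hdiv, hmod]
  rfl

variable [PartialOrder α] [PartialOrder β]

theorem alternatingOpening_opening (h₁ : GaloisConnection l₁ u₁) (h₂ : GaloisConnection l₂ u₂)
    (n : ℕ) :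
    Monotone (alternatingOpening l₁ u₁ l₂ u₂ n) ∧
      (∀ x, alternatingOpening l₁ u₁ l₂ u₂ n (alternatingOpening l₁ u₁ l₂ u₂ n x) =
        alternatingOpening l₁ u₁ l₂ u₂ n x) ∧
      ∀ x, alternatingOpening l₁ u₁ l₂ u₂ n x ≤ x := by
  have hk (k : ℕ) := (h₂.compose h₁).iterate_iterate k
  obtain ⟨k, rfl | rfl⟩ := n.even_or_odd'
  · rw [alternatingOpening_two_mul]
    exact (hk k).opening
  · rw [alternatingOpening_two_mul_add_one]
    exact (h₁.compose (hk k)).opening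

theorem alternatingOpening_antitone (h₁ : GaloisConnection l₁ u₁)
    (h₂ : GaloisConnection l₂ u₂) : Antitone (alternatingOpening l₁ u₁ l₂ u₂) := by
  have hk (k : ℕ) := ((h₂.compose h₁).iterate_iterate k).monotone_l
  refine antitone_nat_of_succ_le fun n x => ?_
  obtain ⟨k, rfl | rfl⟩ := n.even_or_odd'
  · rw [alternatingOpening_two_mul, alternatingOpening_two_mul_add_one]
    exact hk k (h₁.l_u_le _)
  · rw [show 2 * k + 1 + 1 = 2 * (k + 1) by ring, alternatingOpening_two_mul,
      alternatingOpening_two_mul_add_one, Function.iterate_succ (l₁ ∘ l₂),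
      Function.iterate_succ' (u₂ ∘ u₁)]
    exact hk k (h₁.monotone_l (h₂.l_u_le _))

end AlternatingOpening

/-- The families {γ_{λ/2}} and {Γ_{λ/2}} are granulometries. -/
theorem granulometries {V I : Type*} (v : I → Set V) :
    (∀ lam : ℕ,
      (∀ Xv Yv : Set V, Xv ⊆ Yv → gammaLam v lam Xv ⊆ gammaLam v lam Yv) ∧
      (∀ Xv : Set V, gammaLam v lam (gammaLam v lam Xv) = gammaLam v lam Xv) ∧
      (∀ Xv : Set V, gammaLam v lam Xv ⊆ Xv) ∧
      (∀ Xe Ye : Set I, Xe ⊆ Ye → GammaLam v lam Xe ⊆ GammaLam v lam Ye) ∧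
      (∀ Xe : Set I, GammaLam v lam (GammaLam v lam Xe) = GammaLam v lam Xe) ∧
      (∀ Xe : Set I, GammaLam v lam Xe ⊆ Xe)) ∧
    (∀ lam mu : ℕ, lam ≤ mu →
      (∀ Xv : Set V, gammaLam v mu Xv ⊆ gammaLam v lam Xv) ∧
      (∀ Xe : Set I, GammaLam v mu Xe ⊆ GammaLam v lam Xe)) := by
  have hV := gc_dilV_eroE v
  have hE := gc_dilE_eroV v
  refine ⟨fun lam => ?_, fun lam mu h => ?_⟩
  · obtain ⟨monoV, idemV, leV⟩ := alternatingOpening_opening hV hE lam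
    obtain ⟨monoE, idemE, leE⟩ := alternatingOpening_opening hE hV lam
    exact ⟨fun _ _ h => monoV h, idemV, leV, fun _ _ h => monoE h, idemE, leE⟩
  · exact ⟨alternatingOpening_antitone hV hE h, alternatingOpening_antitone hE hV h⟩
end
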